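/- Let n ≥ 4 be an integer, ε ∈ ℂ a primitive (2n−4)-th root of unity, and set L_{n−1} = x^{n−2} − i^n·y^{n−2} and L_n = x^{n−2} + i^n·y^{n−2} in ℂ[x,y], where i is the imaginary unit. Then for every integer k ≥ 0 and every integer j with 2 ≤ j ≤ n−2: the space {f ∈ ℂ[x,y] : f homogeneous of degree 2k(n−2)+j−1 and f(εx, ε^{−1}y) = ε^{j−1}·f(x,y)} equals the ℂ-linear span of the 2k+1 polynomials x^{j−1}·L_{n−1}^{i}·L_n^{2k−i} for 0 ≤ i ≤ 2k. -/

import Mathlib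

open MvPolynomial in
theorem aux_aeval_monomial (a b : ℂ) (m : Fin 2 →₀ ℕ) (c : ℂ) :
    aeval ![C a * X 0, C b * X 1] (monomial m c : MvPolynomial (Fin 2) ℂ)
      = monomial m (a ^ m 0 * b ^ m 1 * c) := by
  rw [aeval_monomial, monomial_eq,
    Finsupp.prod_fintype _ _ (by simp), Finsupp.prod_fintype _ _ (by simp)]
  simp only [Fin.prod_univ_two, Matrix.cons_val_zero, Matrix.cons_val_one, mul_pow, map_mul,
    map_pow, algebraMap_eq]
  ring

open MvPolynomial in
theorem aux_coeff (a b : ℂ) (f : MvPolynomial (Fin 2) ℂ) (m : Fin 2 →₀ ℕ) :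
    coeff m (aeval ![C a * X 0, C b * X 1] f) = a ^ m 0 * b ^ m 1 * coeff m f := by
  induction f using MvPolynomial.induction_on' with
  | monomial u c =>
    rw [aux_aeval_monomial, coeff_monomial, coeff_monomial]
    split_ifs with h
    · rw [h]
    · simp
  | add p q hp hq => rw [map_add, coeff_add, coeff_add, hp, hq]; ring

theorem aux_span {R : Type*} [CommRing R] [Algebra ℂ R] (A B u v : R) (α β γ δ : ℂ)
    (hu : u = α • A + β • B) (hv : v = γ • A + δ • B) (s t : ℕ) :
    u ^ s * v ^ t ∈ Submodule.span ℂ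
      (Set.range (fun i : Fin (s + t + 1) => A ^ (i : ℕ) * B ^ (s + t - (i : ℕ)))) := by
  have hA : ∀ (N : ℕ) (p : R), p ∈ Submodule.span ℂ
      (Set.range (fun i : Fin (N + 1) => A ^ (i : ℕ) * B ^ (N - (i : ℕ)))) → ∀ a b : ℂ,
      (a • A + b • B) * p ∈ Submodule.span ℂ
      (Set.range (fun i : Fin (N + 1 + 1) => A ^ (i : ℕ) * B ^ (N + 1 - (i : ℕ)))) := by
    intro N p hp a b
    induction hp using Submodule.span_induction with
    | mem x hx =>
      obtain ⟨i, rfl⟩ := hx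
      rw [add_mul, smul_mul_assoc, smul_mul_assoc]
      have hi := i.2
      refine Submodule.add_mem _ (Submodule.smul_mem _ _ (Submodule.subset_span ?_))
        (Submodule.smul_mem _ _ (Submodule.subset_span ?_))
      · refine ⟨⟨i + 1, by omega⟩, ?_⟩
        simp only [Nat.add_sub_add_right]
        ring
      · refine ⟨⟨i, by omega⟩, ?_⟩
        have : N + 1 - (i : ℕ) = N - i + 1 := by omega
        simp only [this]
        ring
    | zero => simp
    | add x y _ _ hx hy => rw [mul_add]; exact Submodule.add_mem _ hx hy
    | smul c x _ hx => rw [mul_smul_comm]; exact Submodule.smul_mem _ _ hx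
  have h0 : ∀ t : ℕ, v ^ t ∈ Submodule.span ℂ
      (Set.range (fun i : Fin (t + 1) => A ^ (i : ℕ) * B ^ (t - (i : ℕ)))) := by
    intro t
    induction t with
    | zero => exact Submodule.subset_span ⟨0, by simp⟩
    | succ t ih =>
      have := hA t _ ih γ δ
      rwa [← hv, ← pow_succ'] at this
  induction s with
  | zero =>
    have := h0 t
    rw [pow_zero, one_mul]
    rwa [Nat.zero_add]
  | succ s ih =>
    have := hA _ _ ih α β
    rw [← hu, ← mul_assoc, ← pow_succ'] at this
    rwa [show s + 1 + t = s + t + 1 by omega]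

open MvPolynomial in
/-- for `2 ≤ j ≤ n−2`, the eigenspace
`{f homogeneous of degree 2k(n−2)+j−1, f(εx,ε⁻¹y) = ε^{j−1} f}` is spanned by the
`2k+1` polynomials `x^{j−1} L_{n−1}^{i} L_n^{2k−i}`, `0 ≤ i ≤ 2k`, where
`L_{n−1} = x^{n−2} − iⁿ y^{n−2}` and `L_n = x^{n−2} + iⁿ y^{n−2}`. -/
theorem stmt18 (n : ℕ) (hn : 4 ≤ n) (ε : ℂ) (hε : IsPrimitiveRoot ε (2 * n - 4))
    (k : ℕ) (j : ℕ) (hj1 : 2 ≤ j) (hj2 : j ≤ n - 2) :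
    {f : MvPolynomial (Fin 2) ℂ |
        f.IsHomogeneous (2 * k * (n - 2) + j - 1) ∧
        aeval ![C ε * X 0, C ε⁻¹ * X 1] f = (ε ^ (j - 1)) • f}
      = (Submodule.span ℂ (Set.range (fun i : Fin (2 * k + 1) =>
          (X 0 ^ (j - 1) : MvPolynomial (Fin 2) ℂ) *
          ((X 0 ^ (n - 2) - C (Complex.I ^ n) * X 1 ^ (n - 2)) ^ ((i : ℕ))) *
          ((X 0 ^ (n - 2) + C (Complex.I ^ n) * X 1 ^ (n - 2)) ^ (2 * k - (i : ℕ))))) :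
            Set (MvPolynomial (Fin 2) ℂ)) := by
  obtain ⟨m, rfl⟩ : ∃ m, n = m + 2 := ⟨n - 2, by omega⟩
  obtain ⟨l, rfl⟩ : ∃ l, j = l + 1 := ⟨j - 1, by omega⟩
  have hc : Complex.I ^ (m + 2) ≠ 0 := pow_ne_zero _ Complex.I_ne_zero
  generalize Complex.I ^ (m + 2) = c at hc
  rw [show 2 * (m + 2) - 4 = 2 * m by omega] at hε
  simp only [Nat.add_sub_cancel] at *
  rw [show 2 * k * m + (l + 1) - 1 = 2 * k * m + l by omega]
  have hε0 : ε ≠ 0 := hε.ne_zero (by omega)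
  have hεm : ε ^ m = -1 := by
    have h1 : ε ^ m * ε ^ m = 1 := by rw [← pow_add, ← two_mul]; exact hε.pow_eq_one
    rcases mul_self_eq_one_iff.1 h1 with h | h
    · have := Nat.le_of_dvd (by omega) (hε.dvd_of_pow_eq_one _ h)
      omega
    · exact h
  apply Set.Subset.antisymm
  · rintro f ⟨hf, he⟩
    rw [SetLike.mem_coe, f.as_sum]
    refine Submodule.sum_mem _ fun d hd => ?_
    have hd0 : coeff d f ≠ 0 := mem_support_iff.1 hd
    have hdeg : d 0 + d 1 = 2 * k * m + l := by
      have := hf hd0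
      rw [Finsupp.weight_apply, Finsupp.sum_fintype _ _ (by simp)] at this
      simpa using this
    have hco := congrArg (coeff d) he
    rw [aux_coeff, coeff_smul, smul_eq_mul] at hco
    have hco := mul_right_cancel₀ hd0 hco
    have h2 : ε ^ d 0 = ε ^ (l + d 1) := by
      rw [pow_add, ← hco, mul_assoc, ← mul_pow, inv_mul_cancel₀ hε0, one_pow, mul_one]
    have h3 : ε ^ (2 * d 1) = 1 := by
      have h4 : ε ^ (d 0 + d 1) = ε ^ l := by
        rw [hdeg, pow_add, mul_right_comm, pow_mul, hε.pow_eq_one, one_pow, one_mul]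
      rw [pow_add, h2, ← pow_add, add_assoc, pow_add, ← two_mul] at h4
      exact mul_left_cancel₀ (pow_ne_zero l hε0) (by rw [h4, mul_one])
    obtain ⟨t, ht⟩ := Nat.dvd_of_mul_dvd_mul_left (by norm_num) (hε.dvd_of_pow_eq_one _ h3)
    have htk : t ≤ 2 * k := by
      by_contra hcon
      have : m * (2 * k + 1) ≤ m * t := Nat.mul_le_mul_left _ (by omega)
      nlinarith
    obtain ⟨s, hs⟩ := Nat.exists_eq_add_of_le' htk
    have hd0' : d 0 = l + m * s := by
      have : 2 * k * m = m * s + m * t := by rw [hs]; ring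
      omega
    have hmon : monomial d (coeff d f) = coeff d f •
        ((X 0 : MvPolynomial (Fin 2) ℂ) ^ l * ((X 0 ^ m) ^ s * (X 1 ^ m) ^ t)) := by
      rw [monomial_eq, Finsupp.prod_fintype _ _ (by simp), Fin.prod_univ_two, hd0', ht,
        smul_eq_C_mul]
      ring
    rw [hmon]
    refine Submodule.smul_mem _ _ ?_
    have key := aux_span (X 0 ^ m - C c * X 1 ^ m : MvPolynomial (Fin 2) ℂ)
      (X 0 ^ m + C c * X 1 ^ m) (X 0 ^ m) (X 1 ^ m) (1/2) (1/2) (-(1/2) * c⁻¹) (1/2 * c⁻¹)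
      (by
        rw [← smul_add, sub_add_add_cancel, ← two_smul ℂ, smul_smul]; norm_num)
      (by
        have : (C c⁻¹ * C c : MvPolynomial (Fin 2) ℂ) = 1 := by
          rw [← C_mul, inv_mul_cancel₀ hc, C_1]
        have h2 : (C (1/2) * 2 : MvPolynomial (Fin 2) ℂ) = 1 := by
          rw [show (2 : MvPolynomial (Fin 2) ℂ) = C 2 from rfl, ← C_mul]; norm_num
        simp only [smul_eq_C_mul, C_mul, C_neg]
        linear_combination (-X 1 ^ m) * this + (-X 1 ^ m * C c⁻¹ * C c) * h2) s t
    rw [← hs] at key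
    have := Submodule.mem_map_of_mem (f := LinearMap.mulLeft ℂ ((X 0 : MvPolynomial (Fin 2) ℂ) ^ l)) key
    rw [Submodule.map_span, ← Set.range_comp] at this
    simpa [Function.comp_def, mul_assoc] using this
  · intro f hf
    rw [SetLike.mem_coe] at hf
    induction hf using Submodule.span_induction with
    | mem x hx =>
      obtain ⟨i, rfl⟩ := hx
      have hi := i.2
      have hX : ∀ (a : Fin 2) (r : ℕ), ((X a : MvPolynomial (Fin 2) ℂ) ^ r).IsHomogeneous r :=
        fun a r => by simpa using (isHomogeneous_X ℂ a).pow r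
      have hY : (C c * (X 1 : MvPolynomial (Fin 2) ℂ) ^ m).IsHomogeneous m := by
        simpa using (isHomogeneous_C (Fin 2) c).mul (hX 1 m)
      constructor
      · have := ((hX 0 l).mul (((hX 0 m).sub hY).pow i)).mul (((hX 0 m).add hY).pow (2 * k - i))
        convert this using 1
        obtain ⟨r, hr⟩ := Nat.exists_eq_add_of_le (Nat.lt_succ_iff.1 hi)
        have hr' : 2 * k - (i : ℕ) = r := by omega
        rw [hr']
        linear_combination m * hr
      · simp only [map_mul, map_pow, map_sub, map_add, aeval_X, aeval_C, Matrix.cons_val_zero,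
          Matrix.cons_val_one, mul_pow, algebraMap_eq]
        simp only [← C_pow, inv_pow, hεm, smul_eq_C_mul]
        have h1 : (C (-1 : ℂ) * X 0 ^ m - C c * (C (-1 : ℂ)⁻¹ * X 1 ^ m) : MvPolynomial (Fin 2) ℂ)
          = (-1) * (X 0 ^ m - C c * X 1 ^ m) := by
          rw [inv_neg_one, C_neg, C_1]; ring
        have h2 : (C (-1 : ℂ) * X 0 ^ m + C c * (C (-1 : ℂ)⁻¹ * X 1 ^ m) : MvPolynomial (Fin 2) ℂ)
          = (-1) * (X 0 ^ m + C c * X 1 ^ m) := by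
          rw [inv_neg_one, C_neg, C_1]; ring
        have h3 : (-1 : MvPolynomial (Fin 2) ℂ) ^ (i : ℕ) * (-1) ^ (2 * k - (i : ℕ)) = 1 := by
          rw [← pow_add, show (i : ℕ) + (2 * k - i) = 2 * k by omega, pow_mul]; simp
        rw [h1, h2, mul_pow, mul_pow]
        linear_combination (C (ε ^ l) * X 0 ^ l * (X 0 ^ m - C c * X 1 ^ m) ^ (i : ℕ) *
          (X 0 ^ m + C c * X 1 ^ m) ^ (2 * k - (i : ℕ))) * h3
    | zero => exact ⟨isHomogeneous_zero _ _ _, by simp⟩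
    | add x y _ _ hx hy => exact ⟨hx.1.add hy.1, by rw [map_add, hx.2, hy.2, smul_add]⟩
    | smul a x _ hx =>
      refine ⟨?_, by rw [map_smul, hx.2, smul_comm]⟩
      rw [smul_eq_C_mul]
      simpa using (isHomogeneous_C (Fin 2) a).mul hx.1
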